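/- Let H ≤ F_n be an echelon subgroup with respect to a basis b_1,...,b_n, let k = rank(H), and for j = 0,...,k let i(j) be the minimal integer with rank(H ∩ ⟨b_1,...,b_{i(j)}⟩) ≥ j. Then 0 = i(0) < i(1) < ... < i(k) ≤ n, and there exists a basis h_1,...,h_k of H such that h_1,...,h_j is a basis of H ∩ ⟨b_1,...,b_{i(j)}⟩ for each j = 1,...,k. -/

import Mathlib

/-- `s` is a free basis of the group `G`: the induced map from the free group is bijective. -/
def IsFreeBasis {G : Type} [Group G] {ι : Type} (s : ι → G) : Prop :=
  Function.Bijective (FreeGroup.lift s)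

/-- `s` is a free basis of the subgroup `H` of `G`. -/
def IsBasisOf {G : Type} [Group G] {ι : Type} (s : ι → G) (H : Subgroup G) : Prop :=
  Function.Injective (FreeGroup.lift s) ∧ Subgroup.closure (Set.range s) = H

/-- `A` is a free factor of `G`: `G` is the internal free product of `A` with some subgroup `B`. -/
def IsFreeFactor {G : Type} [Group G] (A : Subgroup G) : Prop :=
  ∃ B : Subgroup G, Function.Bijective (Monoid.Coprod.lift A.subtype B.subtype)

/-- `A` is a free factor of the subgroup `H` of `G`. -/
def IsFreeFactorIn {G : Type} [Group G] (A H : Subgroup G) : Prop :=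
  A ≤ H ∧ IsFreeFactor (A.subgroupOf H)

/-- The subgroup `H` is a free group of rank `r`. -/
def HasRank {G : Type} [Group G] (H : Subgroup G) (r : ℕ) : Prop :=
  Nonempty (FreeGroup (Fin r) ≃* H)

/-- The subgroup generated by the first `i` elements of the family `b`. -/
def prefixSubgroup {G : Type} [Group G] {n : ℕ} (b : Fin n → G) (i : ℕ) : Subgroup G :=
  Subgroup.closure (b '' {j | (j : ℕ) < i})

/-- `b` is an echelon basis for the subgroup `H`: it is a basis of the ambient group and
the ranks of the intersections with the prefix subgroups grow by at most one at each step. -/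
def IsEchelonBasis {G : Type} [Group G] {n : ℕ} (b : Fin n → G) (H : Subgroup G) : Prop :=
  IsFreeBasis b ∧ ∀ i : Fin n, ∃ r r' : ℕ,
    HasRank (H ⊓ prefixSubgroup b (i : ℕ)) r' ∧
    HasRank (H ⊓ prefixSubgroup b ((i : ℕ) + 1)) r ∧ r ≤ r' + 1

/-- `H` is an echelon subgroup: the ambient group admits an ordered basis which is an
echelon basis for `H`. -/
def IsEchelon {G : Type} [Group G] (H : Subgroup G) : Prop :=
  ∃ (m : ℕ) (b : Fin m → G), IsEchelonBasis b H

/-- `B` is the free factor support of `H`: the minimal (by inclusion) free factor containing `H`. -/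
def IsFFSupport {G : Type} [Group G] (H B : Subgroup G) : Prop :=
  IsFreeFactor B ∧ H ≤ B ∧ ∀ B' : Subgroup G, IsFreeFactor B' → H ≤ B' → B ≤ B'

/-- `Reach b v₀ i m v`: `v` is reachable from `v₀` in `m` steps using letters of index `< i`. -/
inductive Reach {G : Type} [Group G] {n : ℕ} {V : Type} [MulAction G V] (b : Fin n → G) (v₀ : V) :
    ℕ → ℕ → V → Prop
  | base (i : ℕ) : Reach b v₀ i 0 v₀
  | pos (i m : ℕ) (v : V) (x : Fin n) : (x : ℕ) < i → Reach b v₀ i m v → Reach b v₀ i (m + 1) (b x • v)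
  | neg (i m : ℕ) (v : V) (x : Fin n) : (x : ℕ) < i → Reach b v₀ i m v →
      Reach b v₀ i (m + 1) ((b x)⁻¹ • v)

theorem Reach.mono {G : Type} [Group G] {n : ℕ} {V : Type} [MulAction G V] {b : Fin n → G} {v₀ : V}
    {i j m : ℕ} {v : V} (h : Reach b v₀ i m v) (hij : i ≤ j) : Reach b v₀ j m v := by
  induction h with
  | base => exact .base _
  | pos m v x hx _ ih => exact .pos _ _ _ _ (by omega) ih
  | neg m v x hx _ ih => exact .neg _ _ _ _ (by omega) ih

theorem prefix_mono {G : Type} [Group G] {n : ℕ} (b : Fin n → G) {i j : ℕ} (h : i ≤ j) :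
    prefixSubgroup b i ≤ prefixSubgroup b j :=
  Subgroup.closure_mono (Set.image_mono fun x (hx : (x : ℕ) < i) => lt_of_lt_of_le hx h)

theorem mem_prefix {G : Type} [Group G] {n : ℕ} (b : Fin n → G) {i : ℕ} {x : Fin n}
    (h : (x : ℕ) < i) : b x ∈ prefixSubgroup b i :=
  Subgroup.subset_closure ⟨x, h, rfl⟩

theorem prefix_top {G : Type} [Group G] {n : ℕ} (b : Fin n → G) (hb : IsFreeBasis b) {i : ℕ}
    (h : n ≤ i) : prefixSubgroup b i = ⊤ := by
  have h1 := FreeGroup.lift_surjective_iff_closure_range_eq_top.1 hb.2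
  rw [← h1, prefixSubgroup]
  congr 1
  ext y
  constructor
  · rintro ⟨x, _, rfl⟩; exact ⟨x, rfl⟩
  · rintro ⟨x, rfl⟩; exact ⟨x, lt_of_lt_of_le x.2 h, rfl⟩

theorem prefix_bot {G : Type} [Group G] {n : ℕ} (b : Fin n → G) : prefixSubgroup b 0 = ⊥ := by
  simp [prefixSubgroup]

theorem reach_of_mem {G : Type} [Group G] {n : ℕ} {V : Type} [MulAction G V] (b : Fin n → G)
    (v₀ : V) (i : ℕ) (g : G) (hg : g ∈ prefixSubgroup b i) :
    ∀ v m, Reach b v₀ i m v → ∃ m', Reach b v₀ i m' (g • v) := by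
  suffices (∀ v m, Reach b v₀ i m v → ∃ m', Reach b v₀ i m' (g • v)) ∧
      (∀ v m, Reach b v₀ i m v → ∃ m', Reach b v₀ i m' (g⁻¹ • v)) from this.1
  induction hg using Subgroup.closure_induction with
  | mem y hy =>
    obtain ⟨x, hx, rfl⟩ := hy
    exact ⟨fun v m h => ⟨_, .pos _ _ _ _ hx h⟩, fun v m h => ⟨_, .neg _ _ _ _ hx h⟩⟩
  | one => simp only [inv_one, one_smul]; exact ⟨fun v m h => ⟨m, h⟩, fun v m h => ⟨m, h⟩⟩
  | mul a c _ _ iha ihc =>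
    constructor
    · intro v m h
      obtain ⟨m', h'⟩ := ihc.1 v m h
      rw [mul_smul]; exact iha.1 _ _ h'
    · intro v m h
      obtain ⟨m', h'⟩ := iha.2 v m h
      rw [mul_inv_rev, mul_smul]; exact ihc.2 _ _ h'
  | inv a _ ih => rw [inv_inv]; exact ⟨ih.2, ih.1⟩

theorem exists_rec {G V β : Type} [Group G] (v₀ : V) (r : V → β) (lt : β → β → Prop)
    (hwf : WellFounded lt) (p : V → V) (a : V → G) (hp : ∀ v, v ≠ v₀ → lt (r (p v)) (r v)) :
    ∃ t : V → G, t v₀ = 1 ∧ ∀ v, v ≠ v₀ → t v = a v * t (p v) := by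
  classical
  have wf : WellFounded (InvImage lt r) := InvImage.wf r hwf
  refine ⟨wf.fix fun v ih => if h : v = v₀ then 1 else a v * ih (p v) (hp v h), ?_, ?_⟩
  · rw [wf.fix_eq]; simp
  · intro v hv
    rw [wf.fix_eq]; simp [hv]

theorem exists_tree {G : Type} [Group G] {n : ℕ} {V : Type} [MulAction G V] (b : Fin n → G)
    (hb : IsFreeBasis b) (v₀ : V) (htr : ∀ v, ∃ g : G, g • v₀ = v) :
    ∃ (t : V → G) (lev : V → ℕ), t v₀ = 1 ∧ lev v₀ = 0 ∧
      (∀ i g v, g ∈ prefixSubgroup b i → lev v ≤ i → lev (g • v) ≤ i) ∧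
      (∀ v, t v ∈ prefixSubgroup b (lev v)) ∧ (∀ v, t v • v₀ = v) ∧
      ∀ P : V → Prop, P v₀ → (∀ v x, P v → t (b x • v) = b x * t v → P (b x • v)) →
        (∀ v x, P (b x • v) → t (b x • v) = b x * t v → P v) → ∀ v, P v := by
  have hex : ∀ v, ∃ z : ℕ ×ₗ ℕ, Reach b v₀ (ofLex z).1 (ofLex z).2 v := by
    intro v
    obtain ⟨g, rfl⟩ := htr v
    obtain ⟨m, hm⟩ := reach_of_mem b v₀ n g (by rw [prefix_top b hb le_rfl]; trivial) v₀ 0 (.base _)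
    exact ⟨toLex (n, m), hm⟩
  have hwf : WellFounded ((· < ·) : ℕ ×ₗ ℕ → ℕ ×ₗ ℕ → Prop) := wellFounded_lt
  have hmin : ∀ v, ∃ z : ℕ ×ₗ ℕ, Reach b v₀ (ofLex z).1 (ofLex z).2 v ∧
      ∀ z' : ℕ ×ₗ ℕ, Reach b v₀ (ofLex z').1 (ofLex z').2 v → z ≤ z' := by
    intro v
    obtain ⟨z, hz, hz'⟩ := hwf.has_min {z : ℕ ×ₗ ℕ | Reach b v₀ (ofLex z).1 (ofLex z).2 v} (hex v)
    exact ⟨z, hz, fun z' h => not_lt.1 (hz' z' h)⟩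
  choose r hr hrmin using hmin
  have hlevle : ∀ i m v, Reach b v₀ i m v → (ofLex (r v)).1 ≤ i := by
    intro i m v h
    have := hrmin v (toLex (i, m)) h
    rw [Prod.Lex.le_iff] at this
    rcases this with h | h
    · exact h.le
    · exact h.1.le
  have hpar : ∀ v, ∃ (w : V) (a : G), v ≠ v₀ → r w < r v ∧ v = a • w ∧
      ∃ x : Fin n, (x : ℕ) < (ofLex (r v)).1 ∧ (a = b x ∨ a = (b x)⁻¹) := by
    intro v
    by_cases hv : v = v₀
    · exact ⟨v, 1, fun h => absurd hv h⟩
    have h := hr v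
    have key : ∀ i m w, Reach b v₀ i m w → i = (ofLex (r v)).1 → m + 1 = (ofLex (r v)).2 →
        r w < r v := by
      intro i m w hw hi hm
      refine lt_of_le_of_lt (hrmin w (toLex (i, m)) hw) ?_
      rw [Prod.Lex.lt_iff]
      right
      exact ⟨hi, by simp; omega⟩
    generalize hi : (ofLex (r v)).1 = i at h key
    generalize hm : (ofLex (r v)).2 = m at h key
    cases h with
    | base => exact absurd rfl hv
    | pos m w x hx hw => exact ⟨w, b x, fun _ => ⟨key _ _ _ hw rfl rfl, rfl, x, by omega, .inl rfl⟩⟩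
    | neg m w x hx hw =>
      exact ⟨w, (b x)⁻¹, fun _ => ⟨key _ _ _ hw rfl rfl, rfl, x, by omega, .inr rfl⟩⟩
  choose p a hpa using hpar
  obtain ⟨t, ht0, ht⟩ := exists_rec v₀ r (· < ·) hwf p a (fun v hv => (hpa v hv).1)
  have ind : ∀ P : V → Prop, P v₀ → (∀ v, v ≠ v₀ → P (p v) → P v) → ∀ v, P v := by
    intro P h0 hs v
    induction v using (InvImage.wf r hwf).induction with
    | _ v ih =>
      by_cases hv : v = v₀
      · rw [hv]; exact h0
      · exact hs v hv (ih _ (hpa v hv).1)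
  have hlev0 : (ofLex (r v₀)).1 = 0 := Nat.le_zero.1 (hlevle 0 0 v₀ (.base _))
  refine ⟨t, fun v => (ofLex (r v)).1, ht0, hlev0, ?_, ?_, ?_, ?_⟩
  · intro i g v hg hv
    obtain ⟨m', h⟩ := reach_of_mem b v₀ i g hg v _ ((hr v).mono hv)
    exact hlevle _ _ _ h
  · refine ind _ ?_ ?_
    · rw [ht0]; exact one_mem _
    · intro v hv ih
      obtain ⟨hlt, -, x, hx, hax⟩ := hpa v hv
      rw [ht v hv]
      have hle : (ofLex (r (p v))).1 ≤ (ofLex (r v)).1 := by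
        rw [Prod.Lex.lt_iff] at hlt
        omega
      refine mul_mem ?_ (prefix_mono b hle ih)
      rcases hax with h | h <;> rw [h]
      · exact mem_prefix b hx
      · exact inv_mem (mem_prefix b hx)
  · refine ind _ ?_ ?_
    · rw [ht0, one_smul]
    · intro v hv ih
      rw [ht v hv, mul_smul, ih]
      exact (hpa v hv).2.1.symm
  · intro P h0 h1 h2
    refine ind P h0 ?_
    intro v hv ih
    obtain ⟨-, hva, x, hx, hax⟩ := hpa v hv
    have htv := ht v hv
    rcases hax with h | h
    · rw [h] at hva htv
      rw [hva]
      refine h1 _ x ih ?_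
      rw [← hva, htv]
    · rw [h] at hva htv
      have hw : p v = b x • v := by rw [eq_comm, hva, smul_inv_smul]; rw [← hva]
      rw [hw] at ih htv
      refine h2 v x ih ?_
      rw [htv, mul_inv_cancel_left]

theorem exists_filtered_basis {G : Type} [Group G] {n : ℕ} (b : Fin n → G)
    (hb : IsFreeBasis b) (H : Subgroup G) :
    ∃ (ι : Type) (s : ι → G) (lev : ι → ℕ), Function.Injective (FreeGroup.lift s) ∧
      ∀ i, Subgroup.closure (s '' {e | lev e ≤ i}) = H ⊓ prefixSubgroup b i := by
  classical
  let V := G ⧸ H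
  let v₀ : V := ((1 : G) : G ⧸ H)
  have hstab : ∀ g : G, g • v₀ = v₀ ↔ g ∈ H := by
    intro g
    change ((g * 1 : G) : G ⧸ H) = ((1 : G) : G ⧸ H) ↔ _
    rw [eq_comm, QuotientGroup.eq]; simp
  obtain ⟨t, lev, ht0, hlev0, hlev, htmem, htv, hind⟩ := exists_tree b hb v₀ (by
    intro v
    obtain ⟨g, rfl⟩ := QuotientGroup.mk_surjective v
    exact ⟨g, by change ((g * 1 : G) : G ⧸ H) = _; rw [mul_one]⟩)
  let ι : Type := {e : Fin n × V // t (b e.1 • e.2) ≠ b e.1 * t e.2}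
  let s : ι → G := fun e => (t (b e.1.1 • e.1.2))⁻¹ * (b e.1.1 * t e.1.2)
  let X := FreeGroup ι
  let f : Fin n → V → X := fun x v =>
    if h : t (b x • v) ≠ b x * t v then FreeGroup.of (⟨(x, v), h⟩ : ι) else 1
  let ρ0 : Fin n → Equiv.Perm (X × V) := fun x =>
    { toFun := fun y => (f x y.2 * y.1, b x • y.2)
      invFun := fun y => ((f x ((b x)⁻¹ • y.2))⁻¹ * y.1, (b x)⁻¹ • y.2)
      left_inv := by
        intro y; simp only [inv_smul_smul]
        exact Prod.ext (inv_mul_cancel_left (G := FreeGroup ι) _ _) rfl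
      right_inv := by
        intro y; simp only [smul_inv_smul]
        exact Prod.ext (mul_inv_cancel_left (G := FreeGroup ι) _ _) rfl }
  let E : FreeGroup (Fin n) ≃* G := MulEquiv.ofBijective (FreeGroup.lift b) hb
  let ρ : G →* Equiv.Perm (X × V) := (FreeGroup.lift ρ0).comp E.symm.toMonoidHom
  have hρ : ∀ x, ρ (b x) = ρ0 x := by
    intro x
    have : E.symm (b x) = FreeGroup.of x := by
      rw [MulEquiv.symm_apply_eq]
      exact (FreeGroup.lift_apply_of (f := b) (x := x)).symm
    simp [ρ, this]
  have hρb : ∀ x y v, ρ (b x) (y, v) = (f x v * y, b x • v) := by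
    intro x y v; rw [hρ]; rfl
  have hρt : ∀ v, ∀ y, ρ (t v) (y, v₀) = (y, v) := by
    refine hind _ ?_ ?_ ?_
    · intro y; rw [ht0, map_one]; rfl
    · intro v x ih h y
      rw [h, map_mul, Equiv.Perm.mul_apply, ih, hρb]
      simp [f, h]
    · intro v x ih h y
      have h1 := ih y
      rw [h, map_mul, Equiv.Perm.mul_apply] at h1
      apply (ρ (b x)).injective
      rw [h1, hρb]
      simp [f, h]
  have hρs : ∀ (e : ι) y, ρ (s e) (y, v₀) = (FreeGroup.of e * y, v₀) := by
    intro e y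
    obtain ⟨⟨x, v⟩, h⟩ := e
    simp only [s]
    rw [map_mul, map_inv, Equiv.Perm.mul_apply, Equiv.Perm.inv_eq_iff_eq, map_mul,
      Equiv.Perm.mul_apply, hρt, hρt, hρb]
    simp only [f]
    rw [dif_pos h]
  have hρw : ∀ (w : FreeGroup ι) y, ρ (FreeGroup.lift s w) (y, v₀) = (w * y, v₀) := by
    intro w
    induction w using FreeGroup.induction_on with
    | C1 => intro y; simp
    | of e => intro y; rw [FreeGroup.lift_apply_of]; exact hρs e y
    | inv_of e ih =>
      intro y
      rw [map_inv, map_inv, Equiv.Perm.inv_eq_iff_eq, ih]; simp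
    | mul a c iha ihc =>
      intro y
      rw [map_mul, map_mul, Equiv.Perm.mul_apply, ihc, iha, mul_assoc]
  refine ⟨ι, s, fun e => max (e.1.1 + 1) (lev e.1.2), ?_, ?_⟩
  · intro w w' h
    have h1 := hρw w 1
    rw [h, hρw] at h1
    simpa using (congrArg Prod.fst h1).symm
  · intro i
    apply le_antisymm
    · rw [Subgroup.closure_le]
      rintro _ ⟨e, he, rfl⟩
      obtain ⟨⟨x, v⟩, h⟩ := e
      simp only [Set.mem_ofPred_eq, max_le_iff] at he
      have hx : b x ∈ prefixSubgroup b i := mem_prefix b (by omega)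
      constructor
      · apply (hstab _).1
        simp only [s]
        rw [mul_smul, mul_smul, htv, inv_smul_eq_iff, htv]
      · simp only [s]
        have h1 := prefix_mono b (hlev i _ _ hx he.2) (htmem _)
        have h2 := prefix_mono b he.2 (htmem _)
        exact (prefixSubgroup b i).mul_mem ((prefixSubgroup b i).inv_mem h1)
          ((prefixSubgroup b i).mul_mem hx h2)
    · rintro g ⟨hgH, hg⟩
      set C := Subgroup.closure (s '' {e : ι | max ((e.1.1 : ℕ) + 1) (lev e.1.2) ≤ i}) with hC
      have key : ∀ v, lev v ≤ i → (t (g • v))⁻¹ * (g * t v) ∈ C := by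
        clear hgH
        have hgi := hg
        change g ∈ prefixSubgroup b i at hgi
        clear hg
        induction hgi using Subgroup.closure_induction with
        | mem y hy =>
          obtain ⟨x, hx, rfl⟩ := hy
          intro v hv
          by_cases h : t (b x • v) = b x * t v
          · rw [h, inv_mul_cancel]; exact one_mem _
          · exact Subgroup.subset_closure ⟨⟨(x, v), h⟩, max_le hx hv, rfl⟩
        | one => intro v hv; simp
        | mul a c ha hc iha ihc =>
          intro v hv
          have := mul_mem (iha (c • v) (hlev i _ _ hc hv)) (ihc v hv)
          rw [← mul_smul] at this
          convert this using 1
          group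
        | inv a ha ih =>
          intro v hv
          have := inv_mem (ih (a⁻¹ • v) (hlev i _ _ (inv_mem ha) hv))
          rw [smul_inv_smul] at this
          convert this using 1
          group
      have := key v₀ (by omega)
      rw [(hstab g).2 hgH, ht0] at this
      simpa using this

theorem lift_comp_injective {G : Type} [Group G] {ι κ : Type} {s : ι → G}
    (hs : Function.Injective (FreeGroup.lift s)) (u : κ → ι) (hu : Function.Injective u) :
    Function.Injective (FreeGroup.lift (s ∘ u)) := by
  have : (FreeGroup.lift (s ∘ u)) = (FreeGroup.lift s).comp (FreeGroup.map u) := by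
    ext x; simp
  rw [this, MonoidHom.coe_comp]
  exact hs.comp (FreeGroup.map_injective hu)

/-- A free basis of a subgroup identifies it with a free group. -/
noncomputable def basisEquiv {G : Type} [Group G] {ι : Type} {s : ι → G} {H : Subgroup G}
    (h : IsBasisOf s H) : FreeGroup ι ≃* H :=
  (MonoidHom.ofInjective h.1).trans
    (MulEquiv.subgroupCongr (FreeGroup.range_lift_eq_closure.trans h.2))

theorem statement18 {n k : ℕ} (H : Subgroup (FreeGroup (Fin n)))
    (b : Fin n → FreeGroup (Fin n)) (hb : IsEchelonBasis b H) (hk : HasRank H k)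
    (iFun : ℕ → ℕ)
    (hmin : ∀ j ≤ k, (∃ r : ℕ, HasRank (H ⊓ prefixSubgroup b (iFun j)) r ∧ j ≤ r) ∧
      ∀ i' < iFun j, ∀ r : ℕ, HasRank (H ⊓ prefixSubgroup b i') r → r < j) :
    iFun 0 = 0 ∧ (∀ j < k, iFun j < iFun (j + 1)) ∧ iFun k ≤ n ∧
    ∃ h : Fin k → FreeGroup (Fin n), IsBasisOf h H ∧
      ∀ (j : ℕ) (hj : j ≤ k),
        IsBasisOf (fun t : Fin j => h ⟨(t : ℕ), lt_of_lt_of_le t.2 hj⟩)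
          (H ⊓ prefixSubgroup b (iFun j)) := by
  classical
  obtain ⟨ι, s, lev, hinj, hcl⟩ := exists_filtered_basis b hb.1 H
  -- sub-bases
  have hbas : ∀ i, IsBasisOf (fun e : {e : ι // lev e ≤ i} => s e) (H ⊓ prefixSubgroup b i) := by
    intro i
    refine ⟨lift_comp_injective hinj Subtype.val Subtype.val_injective, ?_⟩
    rw [← hcl i]
    congr 1
    ext y; simp
  have hsinj : ∀ e, s e ≠ 1 := by
    intro e h
    have : FreeGroup.lift s (FreeGroup.of e) = FreeGroup.lift s 1 := by simpa using h
    exact FreeGroup.of_ne_one e (hinj this)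
  have hlevpos : ∀ e, 0 < lev e := by
    intro e
    by_contra h
    have h0 : s e ∈ H ⊓ prefixSubgroup b 0 := by
      rw [← hcl 0]
      exact Subgroup.subset_closure ⟨e, by simpa using h, rfl⟩
    rw [prefix_bot, inf_bot_eq] at h0
    exact hsinj e h0
  have hbasH : IsBasisOf s H := by
    refine ⟨hinj, le_antisymm ?_ ?_⟩
    · rw [Subgroup.closure_le]
      rintro _ ⟨e, rfl⟩
      have h0 : s e ∈ H ⊓ prefixSubgroup b (lev e) := by
        rw [← hcl]
        exact Subgroup.subset_closure ⟨e, le_refl (lev e), rfl⟩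
      exact h0.1
    · have h1 := hcl n
      rw [prefix_top b hb.1 le_rfl, inf_top_eq] at h1
      calc H = _ := h1.symm
        _ ≤ _ := Subgroup.closure_mono (Set.image_subset_range _ _)
  obtain ⟨eH⟩ := hk
  have eι : ι ≃ Fin k := Equiv.ofFreeGroupEquiv ((basisEquiv hbasH).trans eH.symm)
  haveI : Fintype ι := Fintype.ofEquiv _ eι.symm
  have hcard : Fintype.card ι = k := by rw [Fintype.card_congr eι, Fintype.card_fin]
  have hrank : ∀ i r, HasRank (H ⊓ prefixSubgroup b i) r ↔ r = Fintype.card {e : ι // lev e ≤ i} := by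
    intro i r
    constructor
    · rintro ⟨q⟩
      have := Equiv.ofFreeGroupEquiv ((basisEquiv (hbas i)).trans q.symm)
      rw [Fintype.card_congr this, Fintype.card_fin]
    · rintro rfl
      exact ⟨(FreeGroup.freeGroupCongr (Fintype.equivFin _).symm).trans (basisEquiv (hbas i))⟩
  have hlevn : ∀ e, lev e ≤ n := by
    have h1 : HasRank (H ⊓ prefixSubgroup b n) k := by
      rw [prefix_top b hb.1 le_rfl, inf_top_eq]; exact ⟨eH⟩
    rw [hrank, ← hcard] at h1
    intro e
    by_contra hne
    have := Fintype.card_subtype_lt (p := fun e => lev e ≤ n) hne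
    omega
  have hlevinj : Function.Injective lev := by
    intro e e' hee
    by_contra hne
    obtain ⟨m, hm⟩ : ∃ m, lev e = m + 1 := ⟨lev e - 1, by have := hlevpos e; omega⟩
    have hmn : m < n := by have := hlevn e; omega
    obtain ⟨r, r', h1, h2, h3⟩ := hb.2 ⟨m, hmn⟩
    rw [hrank, Fintype.card_subtype] at h1 h2
    have hsub : insert e (insert e' (Finset.univ.filter fun e => lev e ≤ m)) ⊆
        Finset.univ.filter fun e => lev e ≤ m + 1 := by
      intro z
      simp only [Finset.mem_insert, Finset.mem_filter, Finset.mem_univ, true_and]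
      rintro (rfl | rfl | h) <;> omega
    have := Finset.card_le_card hsub
    rw [Finset.card_insert_of_notMem, Finset.card_insert_of_notMem] at this
    · simp only at h1 h2
      omega
    · simp; omega
    · simp [hne]; omega
  letI : LinearOrder ι := LinearOrder.lift' lev hlevinj
  let σ : Fin k ≃o ι := Fintype.orderIsoFinOfCardEq ι hcard
  have hσ : ∀ t t' : Fin k, lev (σ t) < lev (σ t') ↔ t < t' := fun t t' => σ.lt_iff_lt
  have hσ' : ∀ t t' : Fin k, lev (σ t) ≤ lev (σ t') ↔ t ≤ t' := fun t t' => σ.le_iff_le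
  have hN : ∀ i, Fintype.card {e : ι // lev e ≤ i} =
      (Finset.univ.filter fun t : Fin k => lev (σ t) ≤ i).card := by
    intro i
    rw [← Fintype.card_subtype]
    exact (Fintype.card_congr (σ.toEquiv.subtypeEquiv (fun t => Iff.rfl))).symm
  -- the values of iFun
  have hi0 : iFun 0 = 0 := by
    by_contra h
    have := (hmin 0 (Nat.zero_le _)).2 0 (Nat.pos_of_ne_zero h) _ ((hrank _ _).2 rfl)
    omega
  have hisucc : ∀ (j : ℕ) (hj : j < k), iFun (j + 1) = lev (σ ⟨j, hj⟩) := by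
    intro j hj
    obtain ⟨⟨r, hr, hjr⟩, hm⟩ := hmin (j + 1) hj
    rw [hrank, hN] at hr
    apply le_antisymm
    · by_contra hlt
      have h1 := hm _ (not_le.1 hlt) _ ((hrank _ _).2 rfl)
      rw [hN] at h1
      have h2 : (Finset.univ.filter fun t : Fin k => lev (σ t) ≤ lev (σ ⟨j, hj⟩)) =
          Finset.Iic ⟨j, hj⟩ := by
        ext t; simp [hσ']
      rw [h2, Fin.card_Iic] at h1
      simp at h1
    · by_contra hlt
      have h2 : (Finset.univ.filter fun t : Fin k => lev (σ t) ≤ iFun (j + 1)) ⊆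
          Finset.Iio ⟨j, hj⟩ := by
        intro t ht
        simp only [Finset.mem_filter, Finset.mem_univ, true_and] at ht
        rw [Finset.mem_Iio, ← hσ]
        omega
      have := Finset.card_le_card h2
      rw [Fin.card_Iio] at this
      simp only at this
      omega
  have hiff : ∀ j ≤ k, ∀ t : Fin k, lev (σ t) ≤ iFun j ↔ (t : ℕ) < j := by
    intro j hj t
    cases j with
    | zero => rw [hi0]; have := hlevpos (σ t); omega
    | succ j =>
      rw [hisucc j hj, hσ', Fin.le_def]
      simp only
      omega
  refine ⟨hi0, ?_, ?_, fun t => s (σ t), ?_, ?_⟩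
  · intro j hj
    rw [hisucc j hj]
    by_contra h
    have := (hiff j hj.le ⟨j, hj⟩).1 (not_lt.1 h)
    simp at this
  · cases k with
    | zero => omega
    | succ k => rw [hisucc k (Nat.lt_succ_self k)]; exact hlevn _
  · refine ⟨lift_comp_injective hinj σ σ.injective, ?_⟩
    rw [← hbasH.2]
    congr 1
    exact σ.surjective.range_comp s
  · intro j hj
    refine ⟨lift_comp_injective hinj (fun t : Fin j => σ ⟨(t : ℕ), lt_of_lt_of_le t.2 hj⟩) ?_, ?_⟩
    · intro t t' h
      have := σ.injective h
      simpa [Fin.ext_iff] using this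
    · rw [← hcl]
      congr 1
      ext y
      constructor
      · rintro ⟨t, rfl⟩
        exact ⟨_, (hiff j hj _).2 t.2, rfl⟩
      · rintro ⟨e, he, rfl⟩
        obtain ⟨t, rfl⟩ := σ.surjective e
        exact ⟨⟨t, (hiff j hj t).1 he⟩, rfl⟩
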